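/- arXiv:2111.13733 — 8 statements merged into one kernel-verified Lean document; each statement's English description precedes it below -/
import Mathlib

section
/- Let μ₁ and μ₂ be Borel probability measures on ℝ^d × Fin C (the joint representation–label distributions of two domains). Assume (a) the Z-marginals coincide: the pushforward of μ₁ under (z,y) ↦ z equals the pushforward of μ₂ under (z,y) ↦ z (domain invariance of representations), and (b) there exists a measurable classifier g : ℝ^d → Fin C with zero error on both domains, i.e. μ₁ {(z,y) : g z ≠ y} = 0 and μ₂ {(z,y) : g z ≠ y} = 0 (a common perfect classifier, corresponding to e₂′ = 0). Then the representations are class-conditionally domain-invariant: for every label y ∈ Fin C with μ₁ (ℝ^d × {y}) > 0 and μ₂ (ℝ^d × {y}) > 0, and every Borel set A ⊆ ℝ^d, μ₁ (A × {y}) · μ₂ (ℝ^d × {y}) = μ₂ (A × {y}) · μ₁ (ℝ^d × {y}) (i.e. the conditional distributions of the representation given the label y agree). -/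
open MeasureTheory Set

/-- If `g` predicts the label almost surely, then the mass of `A` within a label class is the
mass that the first marginal gives to the part of `A` where `g` predicts that label. -/
theorem measure_prod_singleton_eq_map_fst {α β : Type*} [MeasurableSpace α] [MeasurableSpace β]
    [MeasurableSingletonClass β] {μ : Measure (α × β)} {g : α → β} (hg : Measurable g)
    (hμ : μ {p : α × β | g p.1 ≠ p.2} = 0) {A : Set α} (hA : MeasurableSet A) (y : β) :
    μ (A ×ˢ {y}) = μ.map Prod.fst (A ∩ g ⁻¹' {y}) := by
  rw [Measure.map_apply measurable_fst (hA.inter (hg (measurableSet_singleton y)))]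
  have h_ae : ∀ᵐ p ∂μ, g p.1 = p.2 := ae_iff.mpr hμ
  refine measure_congr (Filter.eventuallyEq_set.mpr ?_)
  filter_upwards [h_ae] with p hp
  simp [hp]

/-- Proposition 1: if the Z-marginals of two domains coincide and there is a common
measurable classifier with zero error on both domains (`e₂′ = 0`), then the
representations are class-conditionally domain-invariant. -/
theorem class_conditional_invariance_of_invariance_and_common_classifier
    (d C : ℕ) (hC : 1 ≤ C)
    (μ₁ μ₂ : Measure ((Fin d → ℝ) × Fin C))
    [IsProbabilityMeasure μ₁] [IsProbabilityMeasure μ₂]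
    (hmarg : μ₁.map Prod.fst = μ₂.map Prod.fst)
    (g : (Fin d → ℝ) → Fin C) (hg : Measurable g)
    (hg₁ : μ₁ {zy : (Fin d → ℝ) × Fin C | g zy.1 ≠ zy.2} = 0)
    (hg₂ : μ₂ {zy : (Fin d → ℝ) × Fin C | g zy.1 ≠ zy.2} = 0) :
    ∀ y : Fin C,
      0 < μ₁ ((Set.univ : Set (Fin d → ℝ)) ×ˢ ({y} : Set (Fin C))) →
      0 < μ₂ ((Set.univ : Set (Fin d → ℝ)) ×ˢ ({y} : Set (Fin C))) →
      ∀ A : Set (Fin d → ℝ), MeasurableSet A →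
        μ₁ (A ×ˢ ({y} : Set (Fin C))) * μ₂ ((Set.univ : Set (Fin d → ℝ)) ×ˢ ({y} : Set (Fin C)))
          = μ₂ (A ×ˢ ({y} : Set (Fin C)))
              * μ₁ ((Set.univ : Set (Fin d → ℝ)) ×ˢ ({y} : Set (Fin C))) := by
  intro y _ _ A hA
  rw [measure_prod_singleton_eq_map_fst hg hg₁ hA, measure_prod_singleton_eq_map_fst hg hg₂ hA,
    measure_prod_singleton_eq_map_fst hg hg₁ .univ,
    measure_prod_singleton_eq_map_fst hg hg₂ .univ, hmarg]
end

section
/- Let μ and μ′ be Borel probability measures on ℝ^d × Fin C (the joint representation–label distributions of a training domain and a test domain, respectively). Let f : ℝ^d → Fin C be a measurable classifier with zero error on the training domain: μ {(z,y) : f z ≠ y} = 0 (i.e. e₀′ = 0). Assume class-conditional domain invariance: for every label y ∈ Fin C with μ′ (ℝ^d × {y}) > 0, one also has μ (ℝ^d × {y}) > 0, and for every Borel set A ⊆ ℝ^d, μ (A × {y}) · μ′ (ℝ^d × {y}) = μ′ (A × {y}) · μ (ℝ^d × {y}) (equality of the conditional distributions of the representation given the label). Then f also has zero error on the test domain: μ′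 {(z,y) : f z ≠ y} = 0 (i.e. e₃′ = 0). -/
open MeasureTheory Set

/-- Proposition 2: if a measurable classifier `f` has zero error on the training domain `μ`
(`e₀′ = 0`) and the representations are class-conditionally domain-invariant between the
training domain `μ` and the test domain `μ′`, then `f` has zero error on the test domain
(`e₃′ = 0`). -/
theorem zero_test_error_of_class_conditional_invariance
    (d C : ℕ) (hC : 1 ≤ C)
    (μ μ' : Measure ((Fin d → ℝ) × Fin C))
    [IsProbabilityMeasure μ] [IsProbabilityMeasure μ']
    (f : (Fin d → ℝ) → Fin C) (hf : Measurable f)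
    (hf₀ : μ {zy : (Fin d → ℝ) × Fin C | f zy.1 ≠ zy.2} = 0)
    (hinv : ∀ y : Fin C,
      0 < μ' ((Set.univ : Set (Fin d → ℝ)) ×ˢ ({y} : Set (Fin C))) →
        0 < μ ((Set.univ : Set (Fin d → ℝ)) ×ˢ ({y} : Set (Fin C))) ∧
        ∀ A : Set (Fin d → ℝ), MeasurableSet A →
          μ (A ×ˢ ({y} : Set (Fin C))) * μ' ((Set.univ : Set (Fin d → ℝ)) ×ˢ ({y} : Set (Fin C)))
            = μ' (A ×ˢ ({y} : Set (Fin C)))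
                * μ ((Set.univ : Set (Fin d → ℝ)) ×ˢ ({y} : Set (Fin C)))) :
    μ' {zy : (Fin d → ℝ) × Fin C | f zy.1 ≠ zy.2} = 0 := by
  have hcover : {zy : (Fin d → ℝ) × Fin C | f zy.1 ≠ zy.2} ⊆
      ⋃ y : Fin C, (f ⁻¹' {y})ᶜ ×ˢ ({y} : Set (Fin C)) := by
    rintro ⟨z, y⟩ hzy
    exact mem_iUnion.2 ⟨y, hzy, rfl⟩
  refine measure_mono_null hcover (measure_iUnion_null fun y => ?_)
  rcases eq_zero_or_pos (μ' ((univ : Set (Fin d → ℝ)) ×ˢ ({y} : Set (Fin C)))) with h0 | hpos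
  · exact measure_mono_null (prod_mono_left (subset_univ _)) h0
  · obtain ⟨hμ, hcond⟩ := hinv y hpos
    have hμ_error : μ ((f ⁻¹' {y})ᶜ ×ˢ ({y} : Set (Fin C))) = 0 := by
      refine measure_mono_null ?_ hf₀
      rintro ⟨z, _⟩ ⟨hz, rfl⟩
      exact hz
    have h := hcond (f ⁻¹' {y})ᶜ (hf (measurableSet_singleton y)).compl
    rw [hμ_error, zero_mul] at h
    exact (mul_eq_zero.1 h.symm).resolve_right hμ.ne'
end

section
/- Let μ₁ and μ₂ be Borel probability measures on ℝ^d × Fin C. Assume (a) the Z-marginals coincide: the pushforward of μ₁ under (z,y) ↦ z equals the pushforward of μ₂ under (z,y) ↦ z; (b) there exists a measurable classifier g : ℝ^d → Fin C with μ₁ {(z,y) : g z ≠ y} = 0 and μ₂ {(z,y) : g z ≠ y} = 0 (a common perfect classifier, i.e. e₂′ = 0); and (c) a measurable classifier f : ℝ^d → Fin C satisfies μ₁ {(z,y) : f z ≠ y} = 0 (zero training error, i.e. e₀′ = 0). Then μ₂ {(z,y) : f z ≠ y} = 0, i.e. the learned classifier f also has zero error on the second domain (e₃′ = 0). -/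
open MeasureTheory Set

/-- Combination of Propositions 1 and 2: if the Z-marginals of the two domains coincide,
there is a common measurable classifier `g` with zero error on both domains (`e₂′ = 0`),
and a measurable classifier `f` has zero error on the first (training) domain (`e₀′ = 0`),
then `f` also has zero error on the second (test) domain (`e₃′ = 0`). -/
theorem zero_test_error_of_invariance_and_common_classifier
    (d C : ℕ) (hC : 1 ≤ C)
    (μ₁ μ₂ : Measure ((Fin d → ℝ) × Fin C))
    [IsProbabilityMeasure μ₁] [IsProbabilityMeasure μ₂]
    (hmarg : μ₁.map Prod.fst = μ₂.map Prod.fst)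
    (g : (Fin d → ℝ) → Fin C) (hg : Measurable g)
    (hg₁ : μ₁ {zy : (Fin d → ℝ) × Fin C | g zy.1 ≠ zy.2} = 0)
    (hg₂ : μ₂ {zy : (Fin d → ℝ) × Fin C | g zy.1 ≠ zy.2} = 0)
    (f : (Fin d → ℝ) → Fin C) (hf : Measurable f)
    (hf₁ : μ₁ {zy : (Fin d → ℝ) × Fin C | f zy.1 ≠ zy.2} = 0) :
    μ₂ {zy : (Fin d → ℝ) × Fin C | f zy.1 ≠ zy.2} = 0 := by
  have hmeas : MeasurableSet {z | f z ≠ g z} := (measurableSet_eq_fun hf hg).compl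
  have h₁ : μ₁ (Prod.fst ⁻¹' {z | f z ≠ g z}) = 0 := by
    refine measure_mono_null (fun zy hzy => ?_) (measure_union_null hf₁ hg₁)
    by_contra h
    simp only [mem_union, mem_ofPred_eq, not_or, not_not] at h
    exact hzy (h.1.trans h.2.symm)
  have h₂ : μ₂ (Prod.fst ⁻¹' {z | f z ≠ g z}) = 0 := by
    rwa [← Measure.map_apply measurable_fst hmeas, ← hmarg,
      Measure.map_apply measurable_fst hmeas]
  refine measure_mono_null (fun zy hzy => ?_) (measure_union_null h₂ hg₂)
  by_contra h
  simp only [mem_union, mem_preimage, mem_ofPred_eq, not_or, not_not] at h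
  exact hzy (h.1.trans h.2)
end

section
/- Let μ₁ and μ₂ be Borel probability measures on ℝ^d × Fin C. Assume (a) the Z-marginals coincide: the pushforward of μ₁ under (z,y) ↦ z equals the pushforward of μ₂ under (z,y) ↦ z (domain invariance of representations), and (b) there exists a measurable classifier g : ℝ^d → Fin C with μ₁ {(z,y) : g z ≠ y} = 0 and μ₂ {(z,y) : g z ≠ y} = 0 (a common perfect classifier, i.e. e₂′ = 0). Then the label marginals coincide: for every y ∈ Fin C, μ₁ (ℝ^d × {y}) = μ₂ (ℝ^d × {y}). -/
open MeasureTheory Set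

/-- A classifier with zero error on `μ` determines the label marginal from the `Z`-marginal. -/
theorem measure_label_eq_map_fst_preimage {α β : Type*} [MeasurableSpace α] [MeasurableSpace β]
    [MeasurableSingletonClass β] {μ : Measure (α × β)} {g : α → β} (hg : Measurable g)
    (h : μ {zy : α × β | g zy.1 ≠ zy.2} = 0) (y : β) :
    μ ((Set.univ : Set α) ×ˢ ({y} : Set β)) = μ.map Prod.fst (g ⁻¹' {y}) := by
  rw [Measure.map_apply measurable_fst (hg (measurableSet_singleton y))]
  have hae : ∀ᵐ zy ∂μ, g zy.1 = zy.2 := ae_iff.2 h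
  apply measure_congr
  filter_upwards [hae] with zy hzy
  apply propext
  change zy ∈ (Set.univ : Set α) ×ˢ ({y} : Set β) ↔ g zy.1 = y
  simp [hzy]

/-- Label-shift claim from the appendix: if the Z-marginals of the two domains coincide
(domain invariance of representations) and there is a common measurable classifier with zero
error on both domains (`e₂′ = 0`), then the label marginals of the two domains coincide. -/
theorem label_marginals_eq_of_invariance_and_common_classifier
    (d C : ℕ) (hC : 1 ≤ C)
    (μ₁ μ₂ : Measure ((Fin d → ℝ) × Fin C))
    [IsProbabilityMeasure μ₁] [IsProbabilityMeasure μ₂]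
    (hmarg : μ₁.map Prod.fst = μ₂.map Prod.fst)
    (g : (Fin d → ℝ) → Fin C) (hg : Measurable g)
    (hg₁ : μ₁ {zy : (Fin d → ℝ) × Fin C | g zy.1 ≠ zy.2} = 0)
    (hg₂ : μ₂ {zy : (Fin d → ℝ) × Fin C | g zy.1 ≠ zy.2} = 0) :
    ∀ y : Fin C,
      μ₁ ((Set.univ : Set (Fin d → ℝ)) ×ˢ ({y} : Set (Fin C)))
        = μ₂ ((Set.univ : Set (Fin d → ℝ)) ×ˢ ({y} : Set (Fin C))) := by
  intro y
  rw [measure_label_eq_map_fst_preimage hg hg₁, measure_label_eq_map_fst_preimage hg hg₂, hmarg]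
end

section
/- Let n = 2m with m ≥ 1, and let ν₁, …, ν_n be Borel probability measures on ℝ^p × Fin C. Let Θ and W be nonempty sets, and let families h : Θ → (ℝ^p → ℝ^d) and f : W → (ℝ^d → Fin C) be such that for every θ ∈ Θ and w ∈ W the map x ↦ f w (h θ x) is measurable. For a nonempty finite set A ⊆ Fin n define the average error F(A, w, θ) = (1/|A|) · Σ_{i ∈ A} (ν_i {(x, y) : f w (h θ x) ≠ y}) (as a real number). Suppose that for every subset S ⊆ Fin n with |S| = m there are parameters w_S ∈ W and θ_S ∈ Θ that are a global minimum of F on S: F(S, w_S, θ_S) ≤ F(S, w, θ) for all w ∈ W and θ ∈ Θ. Then, averaging over all training–test splits, the training error does not exceed the test-set-inseparability error: Σ_{S ⊆ Fin n, |S| = m} F(S, w_S, θ_S) ≤ Σ_{S ⊆ Fin n, |S| = m} ( ⨅_{w' ∈ W} F(Sᶜ, w', θ_S) ), where Sᶜ denotes the complement of S in Fin n. Equivalently, E_S[e₀′(S)] ≤ E_S[e₁′(S)] when S is a uniformly random size-m subset. -/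
open MeasureTheory

/-- The (0-1 loss) average error of parameters `(w, θ)` over the finite set of domains `A`:
`F(A, w, θ) = (1/|A|) · Σ_{i ∈ A} ν_i {(x, y) : f w (h θ x) ≠ y}`. -/
noncomputable def avgErr {p d C n : ℕ} {Θ W : Type*}
    (ν : Fin n → Measure ((Fin p → ℝ) × Fin C))
    (h : Θ → (Fin p → ℝ) → (Fin d → ℝ)) (f : W → (Fin d → ℝ) → Fin C)
    (A : Finset (Fin n)) (w : W) (θ : Θ) : ℝ :=
  (1 / (A.card : ℝ)) *
    ∑ i ∈ A, (ν i {xy : (Fin p → ℝ) × Fin C | f w (h θ xy.1) ≠ xy.2}).toReal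

/-- Proposition 3 of the appendix: with `n = 2m` domains and, for every size-`m` training
split `S`, parameters `(wS S, θS S)` that are a global minimum of the training error
`F(S, ·, ·)`, the training error does not exceed the test-set-inseparability error on
average over all size-`m` splits:
`Σ_{|S| = m} F(S, wS S, θS S) ≤ Σ_{|S| = m} ⨅_{w'} F(Sᶜ, w', θS S)`,
i.e. `E_S[e₀′(S)] ≤ E_S[e₁′(S)]` for a uniformly random size-`m` subset `S`. -/
theorem avg_e0_le_avg_e1
    (p d C : ℕ) (hC : 1 ≤ C) (m : ℕ) (hm : 1 ≤ m) (n : ℕ) (hn : n = 2 * m)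
    (ν : Fin n → Measure ((Fin p → ℝ) × Fin C)) [∀ i, IsProbabilityMeasure (ν i)]
    (Θ W : Type*) [Nonempty Θ] [Nonempty W]
    (h : Θ → (Fin p → ℝ) → (Fin d → ℝ)) (f : W → (Fin d → ℝ) → Fin C)
    (hmeas : ∀ (w : W) (θ : Θ), Measurable fun x => f w (h θ x))
    (wS : Finset (Fin n) → W) (θS : Finset (Fin n) → Θ)
    (hopt : ∀ S : Finset (Fin n), S.card = m →
      ∀ (w : W) (θ : Θ), avgErr ν h f S (wS S) (θS S) ≤ avgErr ν h f S w θ) :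
    ∑ S ∈ Finset.powersetCard m (Finset.univ : Finset (Fin n)),
        avgErr ν h f S (wS S) (θS S)
      ≤ ∑ S ∈ Finset.powersetCard m (Finset.univ : Finset (Fin n)),
          ⨅ w' : W, avgErr ν h f Sᶜ w' (θS S) := by
  have card_compl_eq : ∀ S ∈ Finset.powersetCard m (Finset.univ : Finset (Fin n)),
      Sᶜ.card = m := by
    intro S hS
    rw [Finset.card_compl, (Finset.mem_powersetCard.mp hS).2, Fintype.card_fin]
    omega
  calc ∑ S ∈ Finset.powersetCard m (Finset.univ : Finset (Fin n)),
        avgErr ν h f S (wS S) (θS S)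
      = ∑ S ∈ Finset.powersetCard m (Finset.univ : Finset (Fin n)),
          avgErr ν h f Sᶜ (wS Sᶜ) (θS Sᶜ) := by
        refine (Finset.sum_nbij' (·ᶜ) (·ᶜ) ?_ ?_ ?_ ?_ ?_).symm
        · exact fun S hS => Finset.mem_powersetCard_univ.mpr (card_compl_eq S hS)
        · exact fun S hS => Finset.mem_powersetCard_univ.mpr (card_compl_eq S hS)
        · exact fun S _ => compl_compl S
        · exact fun S _ => compl_compl S
        · exact fun S _ => rfl
    _ ≤ _ := Finset.sum_le_sum fun S hS =>
        le_ciInf fun w' => hopt Sᶜ (card_compl_eq S hS) w' (θS S)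
end

section
/- Let ν₁, …, ν_n be Borel probability measures on ℝ^p × Fin C, let S ⊆ Fin n be a nonempty proper subset with nonempty complement Sᶜ, let Θ and W be nonempty sets with families h : Θ → (ℝ^p → ℝ^d) and f : W → (ℝ^d → Fin C) such that x ↦ f w (h θ x) is measurable for all (w, θ), and let F(A, w, θ) = (1/|A|) · Σ_{i ∈ A} ν_i {(x, y) : f w (h θ x) ≠ y}. Fix θ ∈ Θ. Suppose w̃ ∈ W minimizes the combined error over all domains, F(Fin n, w̃, θ) ≤ F(Fin n, w', θ) for all w' ∈ W, and suppose w ∈ W minimizes the training error, F(S, w, θ) ≤ F(S, w', θ) for all w' ∈ W. Then e₂′(S) ≤ e₃′(S), i.e. F(Sᶜ, w̃, θ) ≤ F(Sᶜ, w, θ). -/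
open MeasureTheory

/-- Part (ii) of Proposition 4: `e₂′(S) ≤ e₃′(S)`. If `wTilde` minimizes the combined error
over all domains and `w` minimizes the training error on `S`, then
`F(Sᶜ, wTilde, θ) ≤ F(Sᶜ, w, θ)`. -/
theorem e2_le_e3
    (p d C n : ℕ) (hC : 1 ≤ C)
    (ν : Fin n → Measure ((Fin p → ℝ) × Fin C)) [∀ i, IsProbabilityMeasure (ν i)]
    (S : Finset (Fin n)) (hS : S.Nonempty) (hSc : Sᶜ.Nonempty)
    (Θ W : Type*) [Nonempty Θ] [Nonempty W]
    (h : Θ → (Fin p → ℝ) → (Fin d → ℝ)) (f : W → (Fin d → ℝ) → Fin C)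
    (hmeas : ∀ (w : W) (θ : Θ), Measurable fun x => f w (h θ x))
    (θ : Θ) (wTilde : W) (w : W)
    (hwTilde : ∀ w' : W, avgErr ν h f (Finset.univ : Finset (Fin n)) wTilde θ
            ≤ avgErr ν h f (Finset.univ : Finset (Fin n)) w' θ)
    (hw : ∀ w' : W, avgErr ν h f S w θ ≤ avgErr ν h f S w' θ) :
    avgErr ν h f Sᶜ wTilde θ ≤ avgErr ν h f Sᶜ w θ := by
  have hS' : (0 : ℝ) < 1 / (S.card : ℝ) := by
    have := hS.card_pos
    positivity
  have huniv : (0 : ℝ) < 1 / ((Finset.univ : Finset (Fin n)).card : ℝ) := by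
    have := (hS.mono (Finset.subset_univ S)).card_pos
    positivity
  have htotal := le_of_mul_le_mul_left (hwTilde w) huniv
  have htrain := le_of_mul_le_mul_left (hw wTilde) hS'
  rw [← Finset.sum_add_sum_compl S, ← Finset.sum_add_sum_compl S] at htotal
  exact mul_le_mul_of_nonneg_left (by linarith) (by positivity)
end

section
/- Let ν₁, …, ν_n be Borel probability measures on ℝ^p × Fin C, let S ⊆ Fin n be a nonempty proper subset with nonempty complement Sᶜ, and set α = |S| / n ∈ (0, 1). Let Θ and W be nonempty sets with families h : Θ → (ℝ^p → ℝ^d) and f : W → (ℝ^d → Fin C) such that x ↦ f w (h θ x) is measurable for all (w, θ), and let F(A, w, θ) = (1/|A|) · Σ_{i ∈ A} ν_i {(x, y) : f w (h θ x) ≠ y}. Fix θ ∈ Θ and let w̃ ∈ W minimize the combined error: F(Fin n, w̃, θ) ≤ F(Fin n, w', θ) for all w' ∈ W. Then for every w ∈ W, F(Sᶜ, w̃, θ) ≤ F(Sᶜ, w, θ) + (α / (1 − α)) · ( F(S, w, θ) − F(S, w̃, θ) ). (In particular this uses the identity F(Fin n, w', θ) = α · F(S, w', θ) + (1 − α) ·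 F(Sᶜ, w', θ) for the disjoint decomposition Fin n = S ∪ Sᶜ.) -/
open MeasureTheory

/-- The average error over all domains is the convex combination of the average errors over `S`
and over its complement, with weights `|S| / n` and `1 - |S| / n`. -/
theorem avgErr_univ_eq_add_compl {p d C n : ℕ} {Θ W : Type*}
    (ν : Fin n → Measure ((Fin p → ℝ) × Fin C))
    (h : Θ → (Fin p → ℝ) → (Fin d → ℝ)) (f : W → (Fin d → ℝ) → Fin C)
    {S : Finset (Fin n)} (hS : S.Nonempty) (hSc : Sᶜ.Nonempty) (w : W) (θ : Θ) :
    avgErr ν h f Finset.univ w θ =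
      (S.card : ℝ) / n * avgErr ν h f S w θ
        + (1 - (S.card : ℝ) / n) * avgErr ν h f Sᶜ w θ := by
  have hs : (0 : ℝ) < S.card := by exact_mod_cast hS.card_pos
  have hc : (0 : ℝ) < Sᶜ.card := by exact_mod_cast hSc.card_pos
  have hn : (S.card : ℝ) + Sᶜ.card = n := by
    exact_mod_cast (Finset.card_add_card_compl S).trans (Fintype.card_fin n)
  have hn0 : (n : ℝ) ≠ 0 := by linarith
  have hweight : 1 - (S.card : ℝ) / n = Sᶜ.card / n := by
    field_simp
    linarith
  rw [hweight]
  simp only [avgErr, Finset.card_univ, Fintype.card_fin]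
  rw [← Finset.sum_add_sum_compl S]
  field_simp

/-- Inequality (27) of the appendix: with `α = |S| / n` the fraction of training domains and
`wTilde` a minimizer of the combined error over all domains, for every `w`,
`F(Sᶜ, wTilde, θ) ≤ F(Sᶜ, w, θ) + (α / (1 − α)) · (F(S, w, θ) − F(S, wTilde, θ))`. -/
theorem misalignment_key_inequality
    (p d C n : ℕ) (hC : 1 ≤ C)
    (ν : Fin n → Measure ((Fin p → ℝ) × Fin C)) [∀ i, IsProbabilityMeasure (ν i)]
    (S : Finset (Fin n)) (hS : S.Nonempty) (hSc : Sᶜ.Nonempty)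
    (α : ℝ) (hα : α = (S.card : ℝ) / (n : ℝ))
    (Θ W : Type*) [Nonempty Θ] [Nonempty W]
    (h : Θ → (Fin p → ℝ) → (Fin d → ℝ)) (f : W → (Fin d → ℝ) → Fin C)
    (hmeas : ∀ (w : W) (θ : Θ), Measurable fun x => f w (h θ x))
    (θ : Θ) (wTilde : W)
    (hwTilde : ∀ w' : W, avgErr ν h f (Finset.univ : Finset (Fin n)) wTilde θ
            ≤ avgErr ν h f (Finset.univ : Finset (Fin n)) w' θ) :
    ∀ w : W,
      avgErr ν h f Sᶜ wTilde θ
        ≤ avgErr ν h f Sᶜ w θ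
            + (α / (1 - α)) * (avgErr ν h f S w θ - avgErr ν h f S wTilde θ) := by
  intro w
  have hn : 0 < (n : ℝ) := by
    exact_mod_cast hS.card_pos.trans_le ((Finset.card_le_univ S).trans_eq (Fintype.card_fin n))
  have hlt : (S.card : ℝ) < n := by
    have := Finset.card_add_card_compl S
    rw [Fintype.card_fin] at this
    have := hSc.card_pos
    exact_mod_cast (by omega : S.card < n)
  have hα1 : 0 < 1 - α := by
    rw [hα, sub_pos, div_lt_one hn]
    exact hlt
  have hmin := hwTilde w
  rw [avgErr_univ_eq_add_compl ν h f hS hSc, avgErr_univ_eq_add_compl ν h f hS hSc, ← hα] at hmin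
  rw [← sub_le_iff_le_add', div_mul_eq_mul_div, le_div_iff₀ hα1]
  linarith
end

section
/- Let ν₁, …, ν_K be Borel probability measures on ℝ^p × Fin C (the K = n₁ + n₃ training and test domains), and assume uniform label marginals: ν_i (ℝ^p × {y}) = 1 / C for every i ∈ Fin K and every y ∈ Fin C. Let h : ℝ^p → ℝ^d be a fixed feature extractor and let g : Ω → (ℝ^d → Fin K) be a nonempty family of domain classifiers such that x ↦ g ω (h x) is measurable for every ω ∈ Ω. Define the domain-classification error D(ω) = (1/K) · Σ_{i ∈ Fin K} ν_i {(x, y) : g ω (h x) ≠ i}, and for each label y ∈ Fin C the class-conditional domain-classification error D_y(ω) = (1/K) · Σ_{i ∈ Fin K} C · ν_i {(x, y') : y' = y and g ω (h x) ≠ i} (the conditional error given the label equals y, using that each label has probability 1/C). Then d₁′ ≤ d₂′, i.e. with d₁′ = 1 − (⨅_{ω ∈ Ω} D(ω)) − 1/K and d₂′ = 1 − (1/C) · Σ_{y ∈ Fin C} (⨅_{ω ∈ Ω} D_y(ω)) − 1/K, one has d₁′ ≤ d₂′; equivalently, (1/C) · Σ_{y ∈ Fin C} ⨅_{ω ∈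 Ω} D_y(ω) ≤ ⨅_{ω ∈ Ω} D(ω). -/
open MeasureTheory

/-- The mass of a set is the sum of the masses of its slices along a finite second coordinate. -/
theorem sum_measureReal_snd_slices {α β : Type*} [MeasurableSpace α] [MeasurableSpace β]
    [Fintype β] [MeasurableSingletonClass β] (μ : Measure (α × β)) [IsFiniteMeasure μ]
    (P : α × β → Prop) :
    ∑ y : β, (μ {z | z.2 = y ∧ P z}).toReal = (μ {z | P z}).toReal := by
  rw [← ENNReal.toReal_sum fun _ _ => measure_ne_top μ _]
  have hfib : ∀ y : β, MeasurableSet (Prod.snd ⁻¹' ({y} : Set β) : Set (α × β)) := fun y =>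
    measurable_snd (measurableSet_singleton y)
  have hsum := sum_measure_preimage_singleton (μ := μ.restrict {z | P z}) (Finset.univ : Finset β)
    (f := Prod.snd) fun y _ => hfib y
  simp only [Measure.restrict_apply (hfib _), Finset.coe_univ, Set.preimage_univ,
    Measure.restrict_apply_univ] at hsum
  exact congrArg ENNReal.toReal hsum

/-- Proposition 5 of the appendix: `d₁′ ≤ d₂′` under uniform label marginals.
With `K` domains `ν i` on `ℝ^p × Fin C` in which each label has probability `1/C`, a fixed
feature extractor `h` and a family `g ω` of domain classifiers, the training-test domain
distinguishability `d₁′ = 1 − (⨅_ω D(ω)) − 1/K` is at most the class-conditional one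
`d₂′ = 1 − (1/C) · Σ_y (⨅_ω D_y(ω)) − 1/K`, where
`D(ω) = (1/K) · Σ_i ν_i {(x,y) : g ω (h x) ≠ i}` and
`D_y(ω) = (1/K) · Σ_i C · ν_i {(x,y') : y' = y ∧ g ω (h x) ≠ i}`. -/
theorem d1_le_d2
    (p d C K : ℕ) (hC : 1 ≤ C) (hK : 1 ≤ K)
    (ν : Fin K → Measure ((Fin p → ℝ) × Fin C)) [∀ i, IsProbabilityMeasure (ν i)]
    (hlabel : ∀ (i : Fin K) (y : Fin C),
      ν i ((Set.univ : Set (Fin p → ℝ)) ×ˢ ({y} : Set (Fin C))) = 1 / (C : ENNReal))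
    (h : (Fin p → ℝ) → (Fin d → ℝ))
    (Ω : Type*) [Nonempty Ω] (g : Ω → (Fin d → ℝ) → Fin K)
    (hmeas : ∀ ω : Ω, Measurable fun x => g ω (h x)) :
    1 - (⨅ ω : Ω, (1 / (K : ℝ)) *
          ∑ i : Fin K,
            (ν i {xy : (Fin p → ℝ) × Fin C | g ω (h xy.1) ≠ i}).toReal) - 1 / (K : ℝ)
      ≤ 1 - (1 / (C : ℝ)) *
            (∑ y : Fin C, ⨅ ω : Ω, (1 / (K : ℝ)) *
              ∑ i : Fin K,
                (C : ℝ) *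
                  (ν i {xy : (Fin p → ℝ) × Fin C | xy.2 = y ∧ g ω (h xy.1) ≠ i}).toReal)
          - 1 / (K : ℝ) := by
  have hC0 : (C : ℝ) ≠ 0 := by positivity
  suffices hle : (1 / (C : ℝ)) * (∑ y : Fin C, ⨅ ω : Ω, (1 / (K : ℝ)) * ∑ i : Fin K, (C : ℝ) *
      (ν i {xy : (Fin p → ℝ) × Fin C | xy.2 = y ∧ g ω (h xy.1) ≠ i}).toReal) ≤
      ⨅ ω : Ω, (1 / (K : ℝ)) * ∑ i : Fin K,
        (ν i {xy : (Fin p → ℝ) × Fin C | g ω (h xy.1) ≠ i}).toReal by linarith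
  refine le_ciInf fun ω => ?_
  calc
    _ ≤ (1 / (C : ℝ)) * ∑ y : Fin C, (1 / (K : ℝ)) * ∑ i : Fin K, (C : ℝ) *
        (ν i {xy : (Fin p → ℝ) × Fin C | xy.2 = y ∧ g ω (h xy.1) ≠ i}).toReal := by
      gcongr with y
      refine ciInf_le ⟨0, ?_⟩ ω
      rintro _ ⟨ω', rfl⟩
      positivity
    _ = (1 / (K : ℝ)) * ∑ i : Fin K,
        (ν i {xy : (Fin p → ℝ) × Fin C | g ω (h xy.1) ≠ i}).toReal := by
      simp only [← Finset.mul_sum]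
      rw [Finset.sum_comm]
      simp only [sum_measureReal_snd_slices _ fun xy : (Fin p → ℝ) × Fin C => g ω (h xy.1) ≠ _]
      field_simp
end
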